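/- Let m ≥ 1 and a, b_1,…,b_m, c_1,…,c_m ∈ ℂ with a ≠ 0, β_{0,i} = b_i ≠ 0, β_{1,i} = c_i − 1 − b_i ≠ 0 for all i, and γ_w = a − Σ_i w_i c_i + |w| ≠ 0 for all w ∈ {0,1}^m. Let C be the {0,1}^m-indexed matrix with C_{v,v'} = Σ_{w∈{0,1}^m} A_w ∏_{i: w_i=0} δ(v_i,v'_i)/β_{v_i,i} (A_w as the sum over maximal chains below w of ∏ 1/γ_{w^{(j)}}, A_{(0,…,0)} = 1). Let (e_v) be the standard basis of ℂ^{2^m} indexed by {0,1}^m, let σ_j·v be v with the j-th coordinate flipped, Σβ_v = Σ_i β_{v_i,i}, Πβ_v = ∏_i β_{v_i,i}, and f_v = ((a − Σβ_v)/a) e_v − Σ_{j=1}^m (β_{1−v_j,j}/a) e_{σ_j·v}. Then for all u, v ∈ {0,1}^m: Πβ_v · Σ_{w∈{0,1}^m} C_{u,w} (f_v)_w = δ(u,v), i.e. C·f_vᵀ = (1/Πβ_v)·e_vᵀ. -/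

import Mathlib

open Finset
open scoped Classical

/-- `v_i ∈ {0,1}` regarded as a complex number. -/
noncomputable def bval (s : Bool) : ℂ := if s then 1 else 0

/-- The parameters `β_{0,i} = b_i`, `β_{1,i} = c_i − 1 − b_i`. -/
noncomputable def betaP {m : ℕ} (b c : Fin m → ℂ) (s : Bool) (i : Fin m) : ℂ :=
  if s then c i - 1 - b i else b i

/-- `σ_k·v` : flip the `k`-th coordinate of `v`. -/
def flipv {m : ℕ} (k : Fin m) (v : Fin m → Bool) : Fin m → Bool :=
  Function.update v k (!(v k))

/-- The weight `|v| = Σ v_i` of `v ∈ {0,1}^m`. -/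
def wt {m : ℕ} (v : Fin m → Bool) : ℕ := ∑ i, if v i then 1 else 0

/-- `γ_w = a − Σ_i w_i c_i + |w|`. -/
noncomputable def gammaP {m : ℕ} (a : ℂ) (c : Fin m → ℂ) (w : Fin m → Bool) : ℂ :=
  a - ∑ i, (if w i then c i else 0) + (wt w : ℂ)

/-- `A_w = Σ ∏_{j=1}^r 1/γ_{w^{(j)}}`, the sum over all chains
`w = w^{(r)} ≻ w^{(r−1)} ≻ ⋯ ≻ w^{(1)}` with `|w^{(j)}| = j` (here `r = |w|`;
a chain is encoded as `ch : Fin r → {0,1}^m` with `ch j = w^{(j+1)}`, the conditions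
on weights making the inclusions automatically strict);
for `w = (0,…,0)` the empty chain gives `A_w = 1`. -/
noncomputable def Aw {m : ℕ} (γ : (Fin m → Bool) → ℂ) (w : Fin m → Bool) : ℂ :=
  ∑ ch ∈ (univ : Finset (Fin (wt w) → Fin m → Bool)).filter
      (fun ch =>
        (∀ j : Fin (wt w), wt (ch j) = j.val + 1) ∧
        (∀ j : Fin (wt w), j.val = wt w - 1 → ch j = w) ∧
        (∀ j j' : Fin (wt w), j'.val = j.val + 1 →
          ∀ i, ch j i = true → ch j' i = true)),
    ∏ j, 1 / γ (ch j)

/-- The intersection matrix `C` with entries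
`C_{v,v'} = Σ_w A_w · ∏_{i : w_i = 0} δ(v_i, v'_i)/β_{v_i,i}`. -/
noncomputable def Cmat {m : ℕ} (a : ℂ) (b c : Fin m → ℂ) :
    Matrix (Fin m → Bool) (Fin m → Bool) ℂ :=
  fun v v' => ∑ w, Aw (gammaP a c) w *
    ∏ i ∈ univ.filter (fun i => w i = false),
      (if v i = v' i then 1 else 0) / betaP b c (v i) i

/-- `Σβ_v = Σ_i β_{v_i,i}`. -/
noncomputable def Sbeta {m : ℕ} (b c : Fin m → ℂ) (v : Fin m → Bool) : ℂ :=
  ∑ i, betaP b c (v i) i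

/-- `Πβ_v = ∏_i β_{v_i,i}`. -/
noncomputable def Pbeta {m : ℕ} (b c : Fin m → ℂ) (v : Fin m → Bool) : ℂ :=
  ∏ i, betaP b c (v i) i

/-- The standard basis row vector `e_v` of `ℂ^{2^m}`, `(e_v)_w = δ_{v,w}`. -/
noncomputable def evec {m : ℕ} (v : Fin m → Bool) : (Fin m → Bool) → ℂ :=
  fun w => if w = v then 1 else 0

/-- The coordinate row vector `f_v = ((a − Σβ_v)/a) e_v − Σ_j (β_{1−v_j,j}/a) e_{σ_j·v}`
of the class `ψ_v` in the frame `(φ_v)`. -/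
noncomputable def fvec {m : ℕ} (a : ℂ) (b c : Fin m → ℂ) (v : Fin m → Bool) :
    (Fin m → Bool) → ℂ :=
  ((a - Sbeta b c v) / a) • evec v - ∑ j, (betaP b c (!(v j)) j / a) • evec (flipv j v)

/-- The residue matrix `R_k`: `(R_k)_{v,v} = −β_{v_k,k}`, `(R_k)_{v,σ_k·v} = −β_{1−v_k,k}`,
all other entries `0`. -/
noncomputable def Rmat {m : ℕ} (b c : Fin m → ℂ) (k : Fin m) :
    Matrix (Fin m → Bool) (Fin m → Bool) ℂ :=
  fun v w =>
    if w = v then -betaP b c (v k) k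
    else if w = flipv k v then -betaP b c (!(v k)) k
    else 0

section flip

variable {m : ℕ}

lemma wt_eq_card (w : Fin m → Bool) : wt w = #{i | w i = true} := by
  simp [wt]

lemma flipv_same (j : Fin m) (w : Fin m → Bool) : flipv j w j = !(w j) := by
  simp [flipv]

lemma flipv_of_ne {i j : Fin m} (h : i ≠ j) (w : Fin m → Bool) : flipv j w i = w i := by
  simp [flipv, h]

lemma flipv_flipv (j : Fin m) (w : Fin m → Bool) : flipv j (flipv j w) = w := by
  simp [flipv]

lemma flipv_left_injective (w : Fin m → Bool) : Function.Injective fun j => flipv j w := by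
  intro j k h
  by_contra hjk
  have := congrFun h j
  simp [flipv_same, flipv_of_ne hjk] at this

lemma flipv_apply_le {j : Fin m} {w : Fin m → Bool} (hj : w j = true) {i : Fin m}
    (hi : flipv j w i = true) : w i = true := by
  by_cases h : i = j
  · rwa [h]
  · rwa [flipv_of_ne h] at hi

lemma wt_flipv {j : Fin m} {w : Fin m → Bool} (hj : w j = true) : wt (flipv j w) + 1 = wt w := by
  have : (univ.filter fun i => flipv j w i = true) = (univ.filter fun i => w i = true).erase j := by
    ext i
    by_cases h : i = j
    · simp [h, flipv_same, hj]
    · simp [h, flipv_of_ne h]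
  rw [wt_eq_card, wt_eq_card, this, card_erase_add_one (by simpa using hj)]

lemma exists_flipv_eq {x w : Fin m → Bool} (hle : ∀ i, x i = true → w i = true)
    (hwt : wt w = wt x + 1) : ∃ j, w j = true ∧ flipv j w = x := by
  rw [wt_eq_card, wt_eq_card] at hwt
  have hsub : (univ.filter fun i => x i = true) ⊆ univ.filter fun i => w i = true := by
    intro i
    simpa using hle i
  have hcard := card_sdiff_of_subset hsub
  rw [hwt, Nat.add_sub_cancel_left] at hcard
  obtain ⟨j, hj⟩ := card_eq_one.mp hcard
  have key : ∀ i, (w i = true ∧ x i = false) ↔ i = j := by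
    intro i
    simpa using Finset.ext_iff.mp hj i
  obtain ⟨hwj, hxj⟩ := (key j).mpr rfl
  refine ⟨j, hwj, funext fun i => ?_⟩
  by_cases h : i = j
  · rw [h, flipv_same, hwj, hxj, Bool.not_true]
  · rw [flipv_of_ne h]
    have h1 := hle i
    have h2 := (key i).not.mpr h
    cases hw : w i <;> cases hx : x i <;> simp_all

lemma sum_flipv (j : Fin m) (f : (Fin m → Bool) → ℂ) : ∑ w, f (flipv j w) = ∑ w, f w :=
  (Function.Involutive.bijective (flipv_flipv j)).sum_comp f

end flip

section chains

variable {m : ℕ}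

/-- Saturated chains `w^{(1)} ≺ ⋯ ≺ w^{(n)} = w` with `|w^{(j)}| = j`. -/
noncomputable def chainsTo (n : ℕ) (w : Fin m → Bool) : Finset (Fin n → Fin m → Bool) :=
  univ.filter (fun ch =>
    (∀ j : Fin n, wt (ch j) = j.val + 1) ∧
    (∀ j : Fin n, j.val = n - 1 → ch j = w) ∧
    (∀ j j' : Fin n, j'.val = j.val + 1 → ∀ i, ch j i = true → ch j' i = true))

lemma mem_chainsTo {n : ℕ} {w : Fin m → Bool} {ch : Fin n → Fin m → Bool} :
    ch ∈ chainsTo n w ↔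
      (∀ j : Fin n, wt (ch j) = j.val + 1) ∧
      (∀ j : Fin n, j.val = n - 1 → ch j = w) ∧
      (∀ j j' : Fin n, j'.val = j.val + 1 → ∀ i, ch j i = true → ch j' i = true) := by
  simp [chainsTo]

lemma Aw_eq_sum_chainsTo (γ : (Fin m → Bool) → ℂ) {n : ℕ} {w : Fin m → Bool} (h : wt w = n) :
    Aw γ w = ∑ ch ∈ chainsTo n w, ∏ j, 1 / γ (ch j) := by
  subst h
  rfl

lemma Aw_of_wt_eq_zero (γ : (Fin m → Bool) → ℂ) {w : Fin m → Bool} (h : wt w = 0) :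
    Aw γ w = 1 := by
  have : chainsTo 0 w = univ := by
    ext ch
    simp only [mem_chainsTo, IsEmpty.forall_iff, mem_univ, and_self]
  rw [Aw_eq_sum_chainsTo γ h, this]
  simp

lemma chainsTo_one {w : Fin m → Bool} (h : wt w = 1) : chainsTo 1 w = {fun _ => w} := by
  ext ch
  rw [mem_chainsTo, mem_singleton]
  constructor
  · rintro ⟨-, h2, -⟩
    funext j
    exact h2 j (by omega)
  · rintro rfl
    refine ⟨fun j => by rw [h]; omega, fun _ _ => rfl, fun j j' hj => by omega⟩

lemma snoc_mem_chainsTo {n : ℕ} {w : Fin m → Bool} (h : wt w = n + 2) {j : Fin m}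
    (hj : w j = true) {ch : Fin (n + 1) → Fin m → Bool} (hch : ch ∈ chainsTo (n + 1) (flipv j w)) :
    (Fin.snoc ch w : Fin (n + 2) → Fin m → Bool) ∈ chainsTo (n + 2) w := by
  rw [mem_chainsTo] at hch ⊢
  obtain ⟨h1, h2, h3⟩ := hch
  refine ⟨fun k => ?_, fun k hk => ?_, fun k k' hk i => ?_⟩
  · induction k using Fin.lastCases with
    | last => simp [h]
    | cast k => simpa using h1 k
  · obtain rfl : k = Fin.last (n + 1) := Fin.ext (by simpa using hk)
    simp
  · induction k using Fin.lastCases with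
    | last => simp at hk; omega
    | cast k =>
      induction k' using Fin.lastCases with
      | last =>
        simp at hk
        rw [Fin.snoc_castSucc, Fin.snoc_last, h2 k (by omega)]
        exact flipv_apply_le hj
      | cast k' =>
        rw [Fin.snoc_castSucc, Fin.snoc_castSucc]
        exact h3 k k' (by simpa using hk) i

lemma exists_snoc_eq_of_mem_chainsTo {n : ℕ} {w : Fin m → Bool} (h : wt w = n + 2)
    {ch : Fin (n + 2) → Fin m → Bool} (hch : ch ∈ chainsTo (n + 2) w) :
    ∃ j, w j = true ∧ ∃ ch' ∈ chainsTo (n + 1) (flipv j w),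
      (Fin.snoc ch' w : Fin (n + 2) → Fin m → Bool) = ch := by
  rw [mem_chainsTo] at hch
  obtain ⟨h1, h2, h3⟩ := hch
  have hlast : ch (Fin.last (n + 1)) = w := h2 _ (by simp)
  obtain ⟨j, hj, hjw⟩ := exists_flipv_eq (x := ch (Fin.last n).castSucc) (w := w)
    (fun i hi => by
      rw [← hlast]
      exact h3 _ _ (by simp) i hi)
    (by rw [h, h1]; simp)
  refine ⟨j, hj, Fin.init ch, ?_, ?_⟩
  · rw [mem_chainsTo]
    refine ⟨fun k => h1 k.castSucc, fun k hk => ?_, fun k k' hk => h3 _ _ (by simpa using hk)⟩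
    obtain rfl : k = Fin.last n := Fin.ext (by simpa using hk)
    exact hjw.symm
  · conv_lhs => rw [← hlast]
    exact Fin.snoc_init_self ch

/-- Splitting a maximal chain at its top gives `γ_w A_w = Σ_{j : w_j = 1} A_{w - e_j}`. -/
lemma mul_Aw {γ : (Fin m → Bool) → ℂ} {w : Fin m → Bool} (hγ : γ w ≠ 0) (hw : wt w ≠ 0) :
    γ w * Aw γ w = ∑ j, if w j = true then Aw γ (flipv j w) else 0 := by
  rw [← sum_filter]
  obtain ⟨n, hn⟩ := Nat.exists_eq_succ_of_ne_zero hw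
  cases n with
  | zero =>
    have hA : ∀ j ∈ univ.filter (fun j => w j = true), Aw γ (flipv j w) = 1 := by
      intro j hj
      have := wt_flipv (mem_filter.mp hj).2
      exact Aw_of_wt_eq_zero γ (by omega)
    rw [sum_congr rfl hA, sum_const, ← wt_eq_card, Aw_eq_sum_chainsTo γ hn, hn, chainsTo_one hn]
    simp [hγ]
  | succ n =>
    have hA : ∀ j ∈ univ.filter (fun j => w j = true), Aw γ (flipv j w) =
        ∑ ch ∈ chainsTo (n + 1) (flipv j w), ∏ k, 1 / γ (ch k) := by
      intro j hj
      have := wt_flipv (mem_filter.mp hj).2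
      exact Aw_eq_sum_chainsTo γ (by omega)
    rw [sum_congr rfl hA, Aw_eq_sum_chainsTo γ hn, mul_sum, sum_sigma']
    symm
    refine sum_bij (fun p _ => (Fin.snoc p.2 w : Fin (n + 2) → Fin m → Bool)) ?_ ?_ ?_ ?_
    · rintro ⟨j, ch⟩ hp
      simp only [mem_sigma, mem_filter, mem_univ, true_and] at hp
      exact snoc_mem_chainsTo hn hp.1 hp.2
    · rintro ⟨j, ch⟩ hp ⟨j', ch'⟩ hp' heq
      simp only [mem_sigma, mem_filter, mem_univ, true_and, mem_chainsTo] at hp hp'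
      obtain rfl : ch = ch' := (Fin.snoc_injective2 heq).1
      obtain rfl : j = j' := flipv_left_injective w <|
        (hp.2.2.1 (Fin.last n) (by simp)).symm.trans (hp'.2.2.1 (Fin.last n) (by simp))
      rfl
    · intro ch hch
      obtain ⟨j, hj, ch', hch', rfl⟩ := exists_snoc_eq_of_mem_chainsTo hn hch
      exact ⟨⟨j, ch'⟩, by simp [hj, hch'], rfl⟩
    · rintro ⟨j, ch⟩ -
      have hprod : ∏ k, 1 / γ ((Fin.snoc ch w : Fin (n + 2) → Fin m → Bool) k) =
          (∏ k, 1 / γ (ch k)) * (1 / γ w) := by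
        rw [Fin.prod_univ_castSucc]
        simp only [Fin.snoc_castSucc, Fin.snoc_last]
      change _ = γ w * ∏ k, 1 / γ ((Fin.snoc ch w : Fin (n + 2) → Fin m → Bool) k)
      rw [hprod, mul_left_comm, mul_one_div_cancel hγ, mul_one]

end chains

section intersection

variable {m : ℕ}

/-- The factor `∏_{i : w_i = 0} δ(u_i, v_i)/β_{u_i,i}` of the intersection matrix. -/
noncomputable def deltaProd (b c : Fin m → ℂ) (w u v : Fin m → Bool) : ℂ :=
  ∏ i ∈ univ.filter (fun i => w i = false), (if u i = v i then 1 else 0) / betaP b c (u i) i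

lemma deltaProd_flipv_right {b c : Fin m → ℂ} {w : Fin m → Bool} {j : Fin m} (hj : w j = true)
    (u v : Fin m → Bool) : deltaProd b c w u (flipv j v) = deltaProd b c w u v := by
  refine prod_congr rfl fun i hi => ?_
  rw [flipv_of_ne]
  rintro rfl
  simp [hj] at hi

lemma deltaProd_eq_mul {b c : Fin m → ℂ} {w : Fin m → Bool} {j : Fin m} (hj : w j = false)
    (u v : Fin m → Bool) : deltaProd b c w u v =
      (if u j = v j then 1 else 0) / betaP b c (u j) j * deltaProd b c (flipv j w) u v := by
  have : univ.filter (fun i => w i = false) =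
      insert j (univ.filter fun i => flipv j w i = false) := by
    ext i
    by_cases h : i = j
    · simp [h, hj]
    · simp [h, flipv_of_ne h]
  rw [deltaProd, this, prod_insert (by simp [flipv_same, hj])]
  rfl

lemma betaP_add_betaP_not (b c : Fin m → ℂ) (s : Bool) (j : Fin m) :
    betaP b c s j + betaP b c (!s) j = c j - 1 := by
  cases s <;> simp [betaP]

lemma betaP_mul_deltaProd_add {b c : Fin m → ℂ} (hβ : ∀ s i, betaP b c s i ≠ 0)
    (w u v : Fin m → Bool) (j : Fin m) :
    betaP b c (v j) j * deltaProd b c w u v +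
        betaP b c (!(v j)) j * deltaProd b c w u (flipv j v) =
      if w j = true then (c j - 1) * deltaProd b c w u v else deltaProd b c (flipv j w) u v := by
  split_ifs with hj
  · rw [deltaProd_flipv_right hj, ← betaP_add_betaP_not b c (v j) j, add_mul]
  · rw [Bool.not_eq_true] at hj
    rw [deltaProd_eq_mul hj, deltaProd_eq_mul hj u (flipv j v),
      deltaProd_flipv_right (by simp [flipv_same, hj]), flipv_same]
    have h0 := hβ (v j) j
    have h1 := hβ (!(v j)) j
    by_cases h : u j = v j
    · simp [h, h0]
    · have h' : u j = !(v j) := Bool.eq_not.mpr h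
      simp [h', h1]

lemma Pbeta_mul_deltaProd_zero {b c : Fin m → ℂ} (hβ : ∀ s i, betaP b c s i ≠ 0)
    (u v : Fin m → Bool) :
    Pbeta b c v * deltaProd b c (fun _ => false) u v = if u = v then 1 else 0 := by
  simp only [Pbeta, deltaProd, filter_true, ← prod_mul_distrib]
  split_ifs with h
  · subst h
    exact prod_eq_one fun i _ => by simp [hβ]
  · obtain ⟨i, hi⟩ := Function.ne_iff.mp h
    exact prod_eq_zero (mem_univ i) (by simp [hi])

lemma gammaP_eq (a : ℂ) (c : Fin m → ℂ) (w : Fin m → Bool) :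
    gammaP a c w = a - ∑ j, if w j = true then c j - 1 else 0 := by
  have : ∀ j, (if w j = true then c j - 1 else 0) =
      (if w j = true then c j else 0) - (if w j = true then (1 : ℂ) else 0) := by
    intro j
    split_ifs <;> simp
  rw [sum_congr rfl fun j _ => this j, sum_sub_distrib, gammaP, wt]
  push_cast
  ring

lemma Cmat_apply (a : ℂ) (b c : Fin m → ℂ) (u v : Fin m → Bool) :
    Cmat a b c u v = ∑ w, Aw (gammaP a c) w * deltaProd b c w u v :=
  rfl

lemma sum_mul_fvec {a : ℂ} (ha : a ≠ 0) (b c : Fin m → ℂ) (g : (Fin m → Bool) → ℂ)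
    (v : Fin m → Bool) :
    a * ∑ w, g w * fvec a b c v w =
      a * g v - ∑ j, (betaP b c (v j) j * g v + betaP b c (!(v j)) j * g (flipv j v)) := by
  have h : ∑ w, g w * fvec a b c v w =
      (a - Sbeta b c v) / a * g v - ∑ j, betaP b c (!(v j)) j / a * g (flipv j v) := by
    simp only [fvec, evec, Pi.sub_apply, Pi.smul_apply, Finset.sum_apply, smul_eq_mul, mul_sub,
      sum_sub_distrib, mul_sum]
    rw [sum_comm]
    simp [mul_comm]
  rw [h, sum_add_distrib, ← sum_mul, mul_sub, mul_sum, ← Sbeta]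
  have h' : ∀ j, a * (betaP b c (!(v j)) j / a * g (flipv j v)) =
      betaP b c (!(v j)) j * g (flipv j v) := fun j => by field_simp
  rw [sum_congr rfl fun j _ => h' j]
  field_simp
  ring

lemma wt_ne_zero {w : Fin m → Bool} (h : w ≠ fun _ => false) : wt w ≠ 0 := by
  obtain ⟨i, hi⟩ := Function.ne_iff.mp h
  rw [wt_eq_card]
  exact card_ne_zero_of_mem (a := i) (by simpa using hi)

lemma sum_Cmat_mul_fvec {a : ℂ} {b c : Fin m → ℂ} (ha : a ≠ 0)
    (hβ : ∀ s i, betaP b c s i ≠ 0) (hγ : ∀ w : Fin m → Bool, gammaP a c w ≠ 0)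
    (u v : Fin m → Bool) :
    ∑ w, Cmat a b c u w * fvec a b c v w = deltaProd b c (fun _ => false) u v := by
  set A := Aw (gammaP a c) with hA
  set D := fun w => deltaProd b c w u v with hD
  have hreindex : ∀ j, ∑ w, (if w j = true then 0 else A w * D (flipv j w)) =
      ∑ w, if w j = true then A (flipv j w) * D w else 0 := by
    intro j
    rw [← sum_flipv j]
    refine sum_congr rfl fun w _ => ?_
    rw [flipv_same, flipv_flipv]
    cases w j <;> simp
  have hstep : ∀ j, betaP b c (v j) j * Cmat a b c u v +
        betaP b c (!(v j)) j * Cmat a b c u (flipv j v) =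
      ∑ w, ((if w j = true then c j - 1 else 0) * (A w * D w) +
        (if w j = true then A (flipv j w) else 0) * D w) := by
    intro j
    have h1 : ∀ w, betaP b c (v j) j * (A w * D w) +
        betaP b c (!(v j)) j * (A w * deltaProd b c w u (flipv j v)) =
        (if w j = true then c j - 1 else 0) * (A w * D w) +
          if w j = true then 0 else A w * D (flipv j w) := by
      intro w
      have := betaP_mul_deltaProd_add hβ w u v j
      split_ifs at this ⊢ <;> simp only [hD] <;> linear_combination A w * this
    rw [Cmat_apply, Cmat_apply, mul_sum, mul_sum, ← sum_add_distrib,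
      sum_congr rfl fun w _ => h1 w, sum_add_distrib, hreindex, ← sum_add_distrib]
    simp only [ite_mul, zero_mul]
  refine mul_left_cancel₀ ha ?_
  rw [sum_mul_fvec ha b c (Cmat a b c u), sum_congr rfl fun j _ => hstep j, sum_comm, Cmat_apply,
    mul_sum, ← sum_sub_distrib]
  have hterm : ∀ w, a * (A w * D w) - ∑ j, ((if w j = true then c j - 1 else 0) * (A w * D w) +
        (if w j = true then A (flipv j w) else 0) * D w) =
      (gammaP a c w * A w - ∑ j, if w j = true then A (flipv j w) else 0) * D w := by
    intro w
    rw [sum_add_distrib, ← sum_mul, ← sum_mul, gammaP_eq]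
    ring
  rw [sum_congr rfl fun w _ => hterm w, sum_eq_single fun _ => false]
  · have h0 : wt (fun _ : Fin m => false) = 0 := by simp [wt]
    simp [hA, hD, Aw_of_wt_eq_zero _ h0, gammaP_eq]
  · intro w _ hw
    rw [mul_Aw (hγ w) (wt_ne_zero hw), sub_self, zero_mul]
  · simp

end intersection

/-- **Proposition 3.5 (second intersection formula), matrix form.**
`C·f_vᵀ = (1/Πβ_v)·e_vᵀ`, i.e. for all `u, v ∈ {0,1}^m`:
`Πβ_v · Σ_w C_{u,w} (f_v)_w = δ(u,v)`. -/
theorem stmt_4 (m : ℕ) (hm : 1 ≤ m) (a : ℂ) (b c : Fin m → ℂ) (ha : a ≠ 0)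
    (hb0 : ∀ i, betaP b c false i ≠ 0) (hb1 : ∀ i, betaP b c true i ≠ 0)
    (hγ : ∀ w : Fin m → Bool, gammaP a c w ≠ 0) :
    ∀ u v : Fin m → Bool,
      Pbeta b c v * ∑ w, Cmat a b c u w * fvec a b c v w =
        if u = v then 1 else 0 := by
  intro u v
  have hβ : ∀ s i, betaP b c s i ≠ 0 := by
    rintro (_ | _) i
    exacts [hb0 i, hb1 i]
  rw [sum_Cmat_mul_fvec ha hβ hγ, Pbeta_mul_deltaProd_zero hβ]
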